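/- For the Cayley 4-form Φ on ℝ^8 and any vectors v, w ∈ ℝ^8, the 2-form v⌟w⌟Φ satisfies v⌟w⌟Φ = -3(v^♭ ∧ w^♭)_7 + (v^♭ ∧ w^♭)_{21}, where α_7 = (1/4)(α + ⋆(Φ ∧ α)) and α_{21} = (1/4)(3α - ⋆(Φ ∧ α)). -/

import Mathlib

open Finset

noncomputable section

/-- The exterior algebra of (ℝ^8)*, modeled as coefficient functions on basis index sets. -/
abbrev Form := Finset (Fin 8) → ℝ

/-- Sign `(-1)^{#{(i,j) ∈ t × u : j < i}}` arising when merging two wedge monomials. -/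
def esign (t u : Finset (Fin 8)) : ℝ :=
  (-1 : ℝ) ^ ((t ×ˢ u).filter (fun p => p.2 < p.1)).card

/-- Wedge product of forms. -/
def wedge (α β : Form) : Form := fun s =>
  ∑ t ∈ s.powerset, esign t (s \ t) * α t * β (s \ t)

/-- Hodge star for the standard Euclidean metric and orientation `e^{01234567}`,
characterized by `α ∧ ⋆β = ⟨α,β⟩ vol`. -/
def hodge (α : Form) : Form := fun u => esign uᶜ u * α uᶜ

/-- Inner product on forms, making the basis monomials orthonormal. -/
def formInner (α β : Form) : ℝ := ∑ s : Finset (Fin 8), α s * β s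

/-- Basis monomial `e^{i₁} ∧ ⋯ ∧ e^{i_k}` for `s = {i₁ < ⋯ < i_k}`. -/
def eS (s : Finset (Fin 8)) : Form := fun t => if t = s then 1 else 0

/-- `α` is a `k`-form. -/
def IsForm (k : ℕ) (α : Form) : Prop := ∀ s, s.card ≠ k → α s = 0

/-- The standard Cayley (Spin(7)) 4-form on ℝ^8. -/
def Phi : Form :=
  eS {0,1,2,3} - eS {0,1,4,5} - eS {0,1,6,7} - eS {0,2,4,6} + eS {0,2,5,7}
  - eS {0,3,4,7} - eS {0,3,5,6} + eS {4,5,6,7} - eS {2,3,6,7} - eS {2,3,4,5}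
  - eS {1,3,5,7} + eS {1,3,4,6} - eS {1,2,5,6} - eS {1,2,4,7}

/-- Interior product with the basis vector `e_i`. -/
def iota (i : Fin 8) (α : Form) : Form := fun s =>
  if i ∈ s then 0 else (-1 : ℝ) ^ (s.filter (· < i)).card * α (insert i s)

/-- Interior product with the vector `v`. -/
def iotaV (v : Fin 8 → ℝ) (α : Form) : Form := fun s => ∑ i, v i * iota i α s

/-- Musical isomorphism `♭ : ℝ^8 → Λ¹(ℝ^8)*`. -/
def flat (v : Fin 8 → ℝ) : Form := fun s => ∑ i, v i * eS {i} s

/-- Projection onto `Λ²_7` (eigenvalue 3 of `ω ↦ ⋆(Φ ∧ ω)`). -/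
def proj7 (α : Form) : Form := (4 : ℝ)⁻¹ • (α + hodge (wedge Phi α))

/-- Projection onto `Λ²_21` (eigenvalue -1 of `ω ↦ ⋆(Φ ∧ ω)`). -/
def proj21 (α : Form) : Form := (4 : ℝ)⁻¹ • ((3 : ℝ) • α - hodge (wedge Phi α))

/-- Evaluation of a 4-form on four vectors. -/
def ev4 (α : Form) (x y z w : Fin 8 → ℝ) : ℝ :=
  iotaV w (iotaV z (iotaV y (iotaV x α))) ∅

/-- Standard inner product on ℝ^8. -/
def dot (u v : Fin 8 → ℝ) : ℝ := ∑ i, u i * v i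

/-- Standard basis vector. -/
def std (i : Fin 8) : Fin 8 → ℝ := fun j => if j = i then 1 else 0

end

noncomputable section


/-- Integer version of the basis monomials. -/
def eSZ (s t : Finset (Fin 8)) : ℤ := if t = s then 1 else 0

/-- Integer version of the Cayley form. -/
def PhiZ (t : Finset (Fin 8)) : ℤ :=
  eSZ {0,1,2,3} t - eSZ {0,1,4,5} t - eSZ {0,1,6,7} t - eSZ {0,2,4,6} t + eSZ {0,2,5,7} t
  - eSZ {0,3,4,7} t - eSZ {0,3,5,6} t + eSZ {4,5,6,7} t - eSZ {2,3,6,7} t - eSZ {2,3,4,5} t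
  - eSZ {1,3,5,7} t + eSZ {1,3,4,6} t - eSZ {1,2,5,6} t - eSZ {1,2,4,7} t

/-- Integer version of the merging sign. -/
def esignZ (t u : Finset (Fin 8)) : ℤ :=
  (-1 : ℤ) ^ ((t ×ˢ u).filter (fun p => p.2 < p.1)).card

lemma Phi_cast (t : Finset (Fin 8)) : Phi t = (PhiZ t : ℝ) := by
  simp [Phi, PhiZ, eS, eSZ]

lemma esign_cast (t u : Finset (Fin 8)) : esign t u = (esignZ t u : ℝ) := by
  simp [esign, esignZ]

lemma PhiZ_card : ∀ t : Finset (Fin 8), t.card ≠ 4 → PhiZ t = 0 := by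
  decide +kernel

lemma key2 : ∀ s : Finset (Fin 8), s.card = 2 → ∀ i, i ∉ s → ∀ j, j ∉ s → i ≠ j →
    (-1 : ℤ) ^ (s.filter (· < i)).card * ((-1 : ℤ) ^ ((insert i s).filter (· < j)).card *
      PhiZ (insert j (insert i s))) =
    -(esignZ sᶜ s * (esignZ {i} {j} * (esignZ (sᶜ \ {i, j}) {i, j} * PhiZ (sᶜ \ {i, j})))) := by
  decide +kernel

lemma keyZ (s : Finset (Fin 8)) (i j : Fin 8) (hi : i ∉ s) (hj : j ∉ s) (hij : i ≠ j) :
    (-1 : ℤ) ^ (s.filter (· < i)).card * ((-1 : ℤ) ^ ((insert i s).filter (· < j)).card *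
      PhiZ (insert j (insert i s))) =
    -(esignZ sᶜ s * (esignZ {i} {j} * (esignZ (sᶜ \ {i, j}) {i, j} * PhiZ (sᶜ \ {i, j})))) := by
  by_cases hs : s.card = 2
  · exact key2 s hs i hi j hj hij
  · have h1 : (insert j (insert i s)).card = s.card + 2 := by
      rw [card_insert_of_notMem (by simp [hj, hij.symm]), card_insert_of_notMem hi]
    have h2 : sᶜ \ {i, j} = (insert j (insert i s))ᶜ := by
      ext x; simp; tauto
    have h3 : (sᶜ \ {i, j}).card = 8 - (s.card + 2) := by
      rw [h2, card_compl, h1]; simp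
    rw [PhiZ_card _ (by omega), PhiZ_card (sᶜ \ {i, j}) (by omega)]
    simp

lemma wedge_eS (α : Form) (u s : Finset (Fin 8)) :
    wedge α (eS u) s = if u ⊆ s then esign (s \ u) u * α (s \ u) else 0 := by
  unfold wedge
  split_ifs with h
  · rw [Finset.sum_eq_single (s \ u)]
    · have : s \ (s \ u) = u := by simp [h]
      simp [this, eS]
    · intro t ht hne
      have : s \ t ≠ u := by
        rintro rfl
        apply hne
        simp [Finset.mem_powerset.1 ht]
      simp [eS, this]
    · intro h'; exact absurd (by simp) h'
  · apply Finset.sum_eq_zero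
    intro t ht
    have : s \ t ≠ u := by
      rintro rfl
      exact h sdiff_subset
    simp [eS, this]

lemma wedge_single (i j : Fin 8) :
    wedge (eS {i}) (eS {j}) = if i = j then 0 else esign {i} {j} • eS {i, j} := by
  ext s
  rw [wedge_eS]
  by_cases hij : i = j
  · subst hij
    have : s \ {i} ≠ {i} := by
      intro h
      have : i ∈ s \ {i} := by rw [h]; simp
      simp at this
    simp [eS, this]
  · by_cases hs : s = {i, j}
    · subst hs
      have : ({i, j} : Finset (Fin 8)) \ {j} = {i} := by
        ext x; simp; grind
      simp [hij, this, eS]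
    · simp only [hij, if_false, Pi.smul_apply, eS, hs, smul_zero]
      split_ifs with h1 h2
      · exfalso; apply hs
        rw [← sdiff_union_of_subset h1, h2]; rfl
      · simp
      · rfl

lemma wedge_flat (v w : Fin 8 → ℝ) :
    wedge (flat v) (flat w) = ∑ i, ∑ j, (v i * w j) • wedge (eS {i}) (eS {j}) := by
  ext s
  simp only [wedge, flat, Finset.sum_apply, Pi.smul_apply, smul_eq_mul]
  have h : ∀ t ∈ s.powerset, esign t (s \ t) * (∑ i, v i * eS {i} t) * (∑ j, w j * eS {j} (s \ t))
      = ∑ i, ∑ j, v i * w j * (esign t (s \ t) * eS {i} t * eS {j} (s \ t)) := by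
    intro t _
    rw [mul_assoc, Finset.sum_mul_sum, Finset.mul_sum]
    refine Finset.sum_congr rfl fun i _ => ?_
    rw [Finset.mul_sum]
    exact Finset.sum_congr rfl fun j _ => by ring
  rw [Finset.sum_congr rfl h, Finset.sum_comm]
  refine Finset.sum_congr rfl fun i _ => ?_
  rw [Finset.sum_comm]
  exact Finset.sum_congr rfl fun j _ => by rw [Finset.mul_sum]

lemma wedge_add_right (α β γ : Form) : wedge α (β + γ) = wedge α β + wedge α γ := by
  ext s; simp [wedge, mul_add, Finset.sum_add_distrib]

lemma wedge_smul_right (c : ℝ) (α β : Form) : wedge α (c • β) = c • wedge α β := by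
  ext s
  simp only [wedge, Pi.smul_apply, smul_eq_mul, Finset.mul_sum]
  exact Finset.sum_congr rfl fun _ _ => by ring

/-- The operator `ω ↦ ⋆(Φ ∧ ω)` as a linear map. -/
def starPhi : Form →ₗ[ℝ] Form where
  toFun α := hodge (wedge Phi α)
  map_add' α β := by rw [wedge_add_right]; ext s; simp [hodge, mul_add]
  map_smul' c α := by
    rw [wedge_smul_right]; ext s
    simp only [hodge, Pi.smul_apply, smul_eq_mul, RingHom.id_apply]; ring

lemma key (i j : Fin 8) (s : Finset (Fin 8)) :
    iota i (iota j Phi) s = - starPhi (wedge (eS {i}) (eS {j})) s := by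
  rw [wedge_single]
  by_cases hij : i = j
  · subst hij; simp [iota]
  rw [if_neg hij, map_smul]
  simp only [starPhi, LinearMap.coe_mk, AddHom.coe_mk, Pi.smul_apply, smul_eq_mul, hodge, wedge_eS]
  by_cases hi : i ∈ s
  · have : ¬ ({i, j} ⊆ sᶜ) := fun h => by
      have := h (mem_insert_self i _); simp [hi] at this
    simp [iota, hi, this]
  by_cases hj : j ∈ s
  · have : ¬ ({i, j} ⊆ sᶜ) := fun h => by
      have := h (mem_insert_of_mem (mem_singleton_self j)); simp [hj] at this
    simp [iota, hj, this]
  have hsub : {i, j} ⊆ sᶜ := by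
    intro x; simp; rintro (rfl | rfl) <;> assumption
  have hj' : j ∉ insert i s := by simp [hj, Ne.symm hij]
  rw [if_pos hsub]
  simp only [iota, if_neg hi, if_neg hj', Phi_cast, esign_cast]
  have := congrArg (Int.cast : ℤ → ℝ) (keyZ s i j hi hj hij)
  push_cast at this
  rw [this]; ring

/-- for all vectors v, w,
v⌟w⌟Φ = -3 (v♭ ∧ w♭)_7 + (v♭ ∧ w♭)_21. -/
theorem double_contraction_phi (v w : Fin 8 → ℝ) :
    iotaV v (iotaV w Phi) =
      (-3 : ℝ) • proj7 (wedge (flat v) (flat w)) + proj21 (wedge (flat v) (flat w)) := by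
  have h1 : (-3 : ℝ) • proj7 (wedge (flat v) (flat w)) + proj21 (wedge (flat v) (flat w))
      = - starPhi (wedge (flat v) (flat w)) := by
    ext s
    simp only [proj7, proj21, starPhi, LinearMap.coe_mk, AddHom.coe_mk, Pi.add_apply,
      Pi.smul_apply, Pi.sub_apply, Pi.neg_apply, smul_eq_mul]
    ring
  rw [h1, wedge_flat]
  ext s
  simp only [map_sum, map_smul, Pi.neg_apply, Finset.sum_apply, Pi.smul_apply, smul_eq_mul,
    ← Finset.sum_neg_distrib, ← mul_neg, ← key]
  have h2 : ∀ i, iota i (iotaV w Phi) s = ∑ j, w j * iota i (iota j Phi) s := by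
    intro i
    by_cases hi : i ∈ s
    · simp [iota, hi]
    · unfold iota iotaV
      simp only [if_neg hi, Finset.mul_sum]
      exact Finset.sum_congr rfl fun j _ => by unfold iota; ring
  rw [iotaV]
  refine Finset.sum_congr rfl fun i _ => ?_
  rw [h2, Finset.mul_sum]
  exact Finset.sum_congr rfl fun j _ => by ring

end
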